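/- Let θ_ID, θ_OOD ∈ ℝ^d, ρ_ID, ρ_OOD > 0, and define Slope(θ) = (ρ_OOD cos(θ_OOD, θ))/(ρ_ID cos(θ_ID, θ)). Suppose θ_a, θ_b are nonzero with cos(θ_ID, θ_a) > 0, cos(θ_ID, θ_b) > 0 and Slope(θ_a) < Slope(θ_b). Then for every c > 0, Slope(θ_a + cθ_b) > Slope(θ_a), and moreover Slope(θ_a + cθ_b) is strictly increasing in c with limit Slope(θ_b) as c → ∞. -/

import Mathlib

open RealInnerProductSpace Filter

/-- cos(u, v) = ⟨u, v⟩ / (‖u‖‖v‖). -/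
noncomputable def cosAngle {d : ℕ} (u v : EuclideanSpace ℝ (Fin d)) : ℝ :=
  ⟪u, v⟫ / (‖u‖ * ‖v‖)

/-- Effective-robustness slope for ID test distribution `(θID, ρID)` and OOD test
distribution `(θOOD, ρOOD)`. -/
noncomputable def robustSlope {d : ℕ} (θID θOOD : EuclideanSpace ℝ (Fin d)) (ρID ρOOD : ℝ)
    (θ : EuclideanSpace ℝ (Fin d)) : ℝ :=
  (ρOOD * cosAngle θOOD θ) / (ρID * cosAngle θID θ)

lemma robustSlope_eq_aux {d : ℕ} (θID θOOD : EuclideanSpace ℝ (Fin d)) (hID : θID ≠ 0)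
    (hOOD : θOOD ≠ 0) (ρID ρOOD : ℝ) (hρID : 0 < ρID)
    (θ : EuclideanSpace ℝ (Fin d)) (h : 0 < ⟪θID, θ⟫) :
    robustSlope θID θOOD ρID ρOOD θ =
      (ρOOD * ‖θID‖ / (ρID * ‖θOOD‖)) * (⟪θOOD, θ⟫ / ⟪θID, θ⟫) := by
  have hθ : θ ≠ 0 := by
    rintro rfl
    simp at h
  have h1 : ‖θ‖ ≠ 0 := norm_ne_zero_iff.2 hθ
  have h2 : ‖θID‖ ≠ 0 := norm_ne_zero_iff.2 hID
  have h3 : ‖θOOD‖ ≠ 0 := norm_ne_zero_iff.2 hOOD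
  have h4 := h.ne'
  have h5 := hρID.ne'
  unfold robustSlope cosAngle
  field_simp

lemma inner_pos_of_cosAngle_pos_aux {d : ℕ} (u v : EuclideanSpace ℝ (Fin d))
    (h : 0 < cosAngle u v) : 0 < ⟪u, v⟫ := by
  unfold cosAngle at h
  by_contra hn
  have := div_nonpos_of_nonpos_of_nonneg (not_lt.1 hn)
    (mul_nonneg (norm_nonneg u) (norm_nonneg v))
  linarith

/-- adding any positive multiple of a strictly more robust direction `θ_b`
to `θ_a` strictly improves the slope; the improvement is strictly increasing in the
amount `c` added, with limit `Slope(θ_b)` as `c → ∞`. -/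
theorem slope_strictly_improves_along_direction {d : ℕ}
    (θID θOOD : EuclideanSpace ℝ (Fin d)) (hID : θID ≠ 0) (hOOD : θOOD ≠ 0)
    (ρID ρOOD : ℝ) (hρID : 0 < ρID) (hρOOD : 0 < ρOOD)
    (θa θb : EuclideanSpace ℝ (Fin d)) (ha : θa ≠ 0) (hb : θb ≠ 0)
    (hcosa : 0 < cosAngle θID θa) (hcosb : 0 < cosAngle θID θb)
    (hslope : robustSlope θID θOOD ρID ρOOD θa < robustSlope θID θOOD ρID ρOOD θb) :
    (∀ c : ℝ, 0 < c →
        robustSlope θID θOOD ρID ρOOD θa < robustSlope θID θOOD ρID ρOOD (θa + c • θb))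
    ∧ StrictMonoOn (fun c : ℝ => robustSlope θID θOOD ρID ρOOD (θa + c • θb)) (Set.Ioi 0)
    ∧ Tendsto (fun c : ℝ => robustSlope θID θOOD ρID ρOOD (θa + c • θb)) atTop
        (nhds (robustSlope θID θOOD ρID ρOOD θb)) := by
  have hA := inner_pos_of_cosAngle_pos_aux _ _ hcosa
  have hB := inner_pos_of_cosAngle_pos_aux _ _ hcosb
  have key := robustSlope_eq_aux θID θOOD hID hOOD ρID ρOOD hρID
  have hK : 0 < ρOOD * ‖θID‖ / (ρID * ‖θOOD‖) := by
    have h2 := norm_pos_iff.2 hID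
    have h3 := norm_pos_iff.2 hOOD
    positivity
  have keyc : ∀ c : ℝ, 0 ≤ c → robustSlope θID θOOD ρID ρOOD (θa + c • θb) =
      (ρOOD * ‖θID‖ / (ρID * ‖θOOD‖)) *
        ((⟪θOOD, θa⟫ + c * ⟪θOOD, θb⟫) / (⟪θID, θa⟫ + c * ⟪θID, θb⟫)) := by
    intro c hc
    rw [key]
    · simp only [inner_add_right, real_inner_smul_right]
    · simp only [inner_add_right, real_inner_smul_right]
      positivity
  rw [key _ hA, key _ hB] at hslope
  rw [key _ hA, key _ hB]
  generalize ρOOD * ‖θID‖ / (ρID * ‖θOOD‖) = K at *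
  generalize ⟪θOOD, θa⟫ = p at *
  generalize ⟪θOOD, θb⟫ = q at *
  generalize ⟪θID, θa⟫ = A at *
  generalize ⟪θID, θb⟫ = B at *
  have h0 : p / A < q / B := lt_of_mul_lt_mul_left hslope hK.le
  rw [div_lt_div_iff₀ hA hB] at h0
  refine ⟨?_, ?_, ?_⟩
  · intro c hc
    rw [keyc c hc.le]
    apply mul_lt_mul_of_pos_left _ hK
    rw [div_lt_div_iff₀ hA (by positivity)]
    nlinarith [mul_pos hc (sub_pos.2 h0)]
  · intro x hx y hy hxy
    have hx' : 0 < x := hx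
    have hy' : 0 < y := hy
    simp only
    rw [keyc x hx'.le, keyc y hy'.le]
    apply mul_lt_mul_of_pos_left _ hK
    rw [div_lt_div_iff₀ (by positivity) (by positivity)]
    nlinarith [mul_pos (sub_pos.2 hxy) (sub_pos.2 h0)]
  · have hlim : Tendsto (fun c : ℝ => K * ((p * c⁻¹ + q) / (A * c⁻¹ + B))) atTop
        (nhds (K * ((p * 0 + q) / (A * 0 + B)))) := by
      have hi : Tendsto (fun c : ℝ => c⁻¹) atTop (nhds 0) := tendsto_inv_atTop_zero
      exact (((hi.const_mul p).add_const q).div ((hi.const_mul A).add_const B)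
        (by simpa using hB.ne')).const_mul K
    simp only [mul_zero, zero_add] at hlim
    refine hlim.congr' ?_
    filter_upwards [eventually_gt_atTop 0] with c hc
    rw [keyc c hc.le]
    congr 1
    have h1 : A + c * B ≠ 0 := by positivity
    have h2 : A * c⁻¹ + B ≠ 0 := by positivity
    rw [div_eq_div_iff h2 h1]
    field_simp
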